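/- Fix σ > 0. The function f : ℝ → ℝ defined by f(μ) = (1 - Φ((μ - σ²)/σ)) / (1 - Φ(μ/σ)) is strictly increasing on ℝ, where Φ is the standard normal cumulative distribution function. -/

import Mathlib

open Real MeasureTheory

/-- The probability density function of the standard normal distribution. -/
noncomputable def stdNormalPDF (x : ℝ) : ℝ :=
  (Real.sqrt (2 * Real.pi))⁻¹ * Real.exp (-x ^ 2 / 2)

/-- The cumulative distribution function of the standard normal distribution. -/
noncomputable def stdNormalCDF (x : ℝ) : ℝ :=
  ∫ t in Set.Iic x, stdNormalPDF t

lemma setIntegral_pos_of_forall_pos {f : ℝ → ℝ} {s : Set ℝ} (hs : MeasurableSet s)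
    (hvol : 0 < volume s) (hf : IntegrableOn f s) (hpos : ∀ x ∈ s, 0 < f x) :
    0 < ∫ x in s, f x := by
  rw [setIntegral_pos_iff_support_of_nonneg_ae
    ((ae_restrict_iff' hs).2 (.of_forall fun x hx => (hpos x hx).le)) hf]
  rwa [Set.inter_eq_right.2 fun x hx => Function.mem_support.2 (hpos x hx).ne']

lemma stdNormalPDF_eq_gaussianPDFReal :
    stdNormalPDF = ProbabilityTheory.gaussianPDFReal 0 1 := by
  funext x
  simp [stdNormalPDF, ProbabilityTheory.gaussianPDFReal]

lemma integrable_stdNormalPDF : Integrable stdNormalPDF := by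
  rw [stdNormalPDF_eq_gaussianPDFReal]
  exact ProbabilityTheory.integrable_gaussianPDFReal 0 1

lemma stdNormalPDF_pos (x : ℝ) : 0 < stdNormalPDF x := by
  unfold stdNormalPDF
  positivity

lemma one_sub_stdNormalCDF (x : ℝ) :
    1 - stdNormalCDF x = ∫ t in Set.Ioi x, stdNormalPDF t := by
  have h := integral_add_compl (measurableSet_Iic (a := x)) integrable_stdNormalPDF
  have h_total : ∫ t, stdNormalPDF t = 1 := by
    rw [stdNormalPDF_eq_gaussianPDFReal]
    exact ProbabilityTheory.integral_gaussianPDFReal_eq_one 0 one_ne_zero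
  rw [Set.compl_Iic, h_total] at h
  rw [stdNormalCDF]
  linarith

lemma one_sub_stdNormalCDF_pos (x : ℝ) : 0 < 1 - stdNormalCDF x := by
  rw [one_sub_stdNormalCDF]
  exact setIntegral_pos_of_forall_pos measurableSet_Ioi (by simp)
    integrable_stdNormalPDF.integrableOn fun t _ => stdNormalPDF_pos t

lemma stdNormalPDF_sub (s t : ℝ) :
    stdNormalPDF (t - s) = exp (s * t - s ^ 2 / 2) * stdNormalPDF t := by
  rw [stdNormalPDF, stdNormalPDF, mul_left_comm, ← exp_add]
  congr 2
  ring

lemma one_sub_stdNormalCDF_sub (x s : ℝ) :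
    1 - stdNormalCDF (x - s) = ∫ t in Set.Ioi x, stdNormalPDF (t - s) := by
  rw [one_sub_stdNormalCDF]
  have h := (measurePreserving_sub_right volume s).setIntegral_preimage_emb
    (MeasurableEquiv.subRight s).measurableEmbedding stdNormalPDF (Set.Ioi (x - s))
  rw [← h]
  simp

/-- Log-concavity of the Gaussian tail, in the form of a cross-multiplied shift inequality. -/
lemma one_sub_stdNormalCDF_sub_mul_lt {s a b : ℝ} (hs : 0 < s) (hab : a < b) :
    (1 - stdNormalCDF (a - s)) * (1 - stdNormalCDF b) <
      (1 - stdNormalCDF (b - s)) * (1 - stdNormalCDF a) := by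
  have h_int : Integrable fun t => stdNormalPDF (t - s) :=
    integrable_stdNormalPDF.comp_sub_right s
  have h_split {f : ℝ → ℝ} (hf : Integrable f) :
      ∫ t in Set.Ioi a, f t = (∫ t in Set.Ioc a b, f t) + ∫ t in Set.Ioi b, f t := by
    rw [← Set.Ioc_union_Ioi_eq_Ioi hab.le]
    exact setIntegral_union (Set.Ioc_disjoint_Ioi le_rfl) measurableSet_Ioi
      hf.integrableOn hf.integrableOn
  have hq := one_sub_stdNormalCDF_pos b
  have hp : 0 < ∫ t in Set.Ioc a b, stdNormalPDF t :=
    setIntegral_pos_of_forall_pos measurableSet_Ioc (by simpa using hab)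
      integrable_stdNormalPDF.integrableOn fun t _ => stdNormalPDF_pos t
  rw [one_sub_stdNormalCDF_sub, one_sub_stdNormalCDF_sub, one_sub_stdNormalCDF a,
    h_split h_int, h_split integrable_stdNormalPDF]
  rw [one_sub_stdNormalCDF] at hq ⊢
  set c := exp (s * b - s ^ 2 / 2)
  have h_left : ∫ t in Set.Ioc a b, stdNormalPDF (t - s) ≤
      c * ∫ t in Set.Ioc a b, stdNormalPDF t := by
    rw [← integral_const_mul]
    refine setIntegral_mono_on h_int.integrableOn
      (integrable_stdNormalPDF.const_mul c).integrableOn measurableSet_Ioc fun t ht => ?_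
    rw [stdNormalPDF_sub]
    refine mul_le_mul_of_nonneg_right (exp_le_exp.2 ?_) (stdNormalPDF_pos t).le
    have := mul_le_mul_of_nonneg_left ht.2 hs.le
    linarith
  have h_right : c * ∫ t in Set.Ioi b, stdNormalPDF t <
      ∫ t in Set.Ioi b, stdNormalPDF (t - s) := by
    rw [← integral_const_mul, ← sub_pos, ← integral_sub h_int.integrableOn
      (integrable_stdNormalPDF.const_mul c).integrableOn]
    refine setIntegral_pos_of_forall_pos measurableSet_Ioi (by simp)
      (h_int.sub (integrable_stdNormalPDF.const_mul c)).integrableOn fun t ht => ?_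
    rw [stdNormalPDF_sub, sub_pos]
    refine mul_lt_mul_of_pos_right (exp_lt_exp.2 ?_) (stdNormalPDF_pos t)
    have := mul_lt_mul_of_pos_left (Set.mem_Ioi.1 ht) hs
    linarith
  have h₁ := mul_le_mul_of_nonneg_right h_left hq.le
  have h₂ := mul_lt_mul_of_pos_right h_right hp
  linarith

/-- For `σ > 0`, the ratio of Gaussian tail probabilities
`μ ↦ (1 - Φ((μ - σ²)/σ)) / (1 - Φ(μ/σ))` is strictly increasing on `ℝ`. -/
theorem tail_ratio_strictMono (σ : ℝ) (hσ : 0 < σ) :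
    StrictMono (fun μ : ℝ =>
      (1 - stdNormalCDF ((μ - σ ^ 2) / σ)) / (1 - stdNormalCDF (μ / σ))) := by
  intro μ ν h
  have h_shift (x : ℝ) : (x - σ ^ 2) / σ = x / σ - σ := by
    field_simp
  simp only [h_shift]
  rw [div_lt_div_iff₀ (one_sub_stdNormalCDF_pos _) (one_sub_stdNormalCDF_pos _)]
  exact one_sub_stdNormalCDF_sub_mul_lt hσ (div_lt_div_of_pos_right h hσ)
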